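/- For each n ≥ 1, occurrences of the subword pattern 1^m (for fixed m ≥ 1) in non-crossing partitions of [n] are in bijection with pairs (π, i) where π ∈ NC_r with r = n − m + 1 and i ∈ [r]: inserting m−1 extra copies of the letter π_i immediately after position i yields a member of NC_n with a marked occurrence of 1^m, and every marked occurrence arises uniquely this way. Hence the total number of occurrences of 1^m over NC_n is r·C_r. -/

import Mathlib

/-- `l` is a restricted growth sequence (canonical sequential form of a set
partition): it starts with 1, all letters are ≥ 1, and each letter is at most
one more than the maximum of the preceding prefix. -/
def IsRGS (l : List ℕ) : Prop :=
  l.getD 0 1 = 1 ∧ (∀ x ∈ l, 1 ≤ x) ∧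
  ∀ i, i + 1 < l.length → l.getD (i + 1) 0 ≤ (l.take (i + 1)).foldr max 0 + 1

/-- `l` contains a (classical) occurrence of 1-2-1-2: a subsequence a,b,a,b with a < b. -/
def Crossing (l : List ℕ) : Prop :=
  ∃ i j k m : ℕ, i < j ∧ j < k ∧ k < m ∧ m < l.length ∧
    l.getD i 0 = l.getD k 0 ∧ l.getD j 0 = l.getD m 0 ∧ l.getD i 0 < l.getD j 0

/-- `l` is the canonical sequential form of a non-crossing partition of [n]. -/
def NCseq (n : ℕ) (l : List ℕ) : Prop := l.length = n ∧ IsRGS l ∧ ¬ Crossing l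

/-- Two lists of the same length are order-isomorphic. -/
def OrdIso (s t : List ℕ) : Prop :=
  s.length = t.length ∧ ∀ j k, j < s.length → k < s.length →
    (s.getD j 0 < s.getD k 0 ↔ t.getD j 0 < t.getD k 0)

/-- The subword pattern `τ` occurs in `l` starting at position `i`. -/
def occAt (τ l : List ℕ) (i : ℕ) : Prop := OrdIso τ ((l.drop i).take τ.length)

/-- The number of occurrences of the subword pattern `τ` in `l`. -/
noncomputable def occCount (τ l : List ℕ) : ℕ := Nat.card {i : ℕ // occAt τ l i}

/-- The total number of occurrences of the subword pattern `τ` over all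
members of NC_n, counted with multiplicity (as marked occurrences). -/
noncomputable def totalOcc (n : ℕ) (τ : List ℕ) : ℕ :=
  Nat.card {p : List ℕ × ℕ // NCseq n p.1 ∧ occAt τ p.1 p.2}

open List in
theorem crossing_iff_sublist (l : List ℕ) :
    Crossing l ↔ ∃ a b, a < b ∧ [a, b, a, b] <+ l := by
  constructor
  · rintro ⟨i, j, k, m, hij, hjk, hkm, hm, hik, hjm, hlt⟩
    refine ⟨l.getD i 0, l.getD j 0, hlt, ?_⟩
    have h : (([⟨i, by omega⟩, ⟨j, by omega⟩, ⟨k, by omega⟩, ⟨m, hm⟩] :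
        List (Fin l.length)).map l.get) <+ l := by
      apply List.map_getElem_sublist
      simp
      omega
    rw [List.getD_eq_getElem _ _ (by omega)] at *
    simp only [List.getD_eq_getElem _ _ hm,
      List.getD_eq_getElem _ _ (show j < l.length by omega),
      List.getD_eq_getElem _ _ (show k < l.length by omega)] at *
    simpa [← hik, ← hjm] using h
  · rintro ⟨a, b, hab, h⟩
    obtain ⟨f, hf⟩ := List.sublist_iff_exists_fin_orderEmbedding_get_eq.1 h
    refine ⟨f 0, f 1, f 2, f 3, ?_, ?_, ?_, (f 3).2, ?_⟩
    · exact f.lt_iff_lt.2 (by simp)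
    · exact f.lt_iff_lt.2 (by simp [Fin.lt_def])
    · exact f.lt_iff_lt.2 (by simp [Fin.lt_def])
    · have h0 := hf 0
      have h1 := hf 1
      have h2 := hf 2
      have h3 := hf 3
      simp at h0 h1 h2 h3
      simp [← h0, ← h1, ← h2, ← h3, hab]

theorem foldr_max_append (u v : List ℕ) :
    (u ++ v).foldr max 0 = max (u.foldr max 0) (v.foldr max 0) := by
  induction u with
  | nil => simp
  | cons a u ih => simp [ih, max_assoc]

theorem le_foldr_max {w : List ℕ} {x : ℕ} (h : x ∈ w) : x ≤ w.foldr max 0 := by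
  induction w with
  | nil => simp at h
  | cons a w ih =>
    rcases List.mem_cons.1 h with rfl | h
    · simp
    · simp [ih h]

theorem isRGS_nil : IsRGS [] := by simp [IsRGS]

theorem isRGS_concat (w : List ℕ) (c : ℕ) :
    IsRGS (w ++ [c]) ↔ IsRGS w ∧ 1 ≤ c ∧ c ≤ w.foldr max 0 + 1 := by
  rcases w.eq_nil_or_concat with rfl | ⟨v, d, rfl⟩
  · simp [IsRGS]
    omega
  · set w := v.concat d with hw
    have hlen : 0 < w.length := by simp [hw]
    have h0 : (w ++ [c]).getD 0 1 = w.getD 0 1 := List.getD_append _ _ _ _ hlen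
    unfold IsRGS
    rw [h0]
    constructor
    · rintro ⟨h1, h2, h3⟩
      refine ⟨⟨h1, fun x hx => h2 x (by simp [hx]), fun i hi => ?_⟩, h2 c (by simp), ?_⟩
      · have := h3 i (by simp; omega)
        rwa [List.getD_append _ _ _ _ hi, List.take_append_of_le_length (by omega)] at this
      · have := h3 (w.length - 1) (by simp; omega)
        rw [Nat.sub_add_cancel hlen, List.getD_append_right _ _ _ _ le_rfl,
          List.take_append_of_le_length le_rfl] at this
        simpa using this
    · rintro ⟨⟨h1, h2, h3⟩, h4, h5⟩
      refine ⟨h1, fun x hx => ?_, fun i hi => ?_⟩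
      · rcases List.mem_append.1 hx with hx | hx
        · exact h2 x hx
        · simp at hx; omega
      · rw [List.length_append, List.length_singleton] at hi
        rw [List.take_append_of_le_length (by omega)]
        rcases Nat.lt_or_ge (i + 1) w.length with hlt | hge
        · rw [List.getD_append _ _ _ _ hlt]
          exact h3 i hlt
        · have : i + 1 = w.length := by omega
          rw [this, List.getD_append_right _ _ _ _ le_rfl]
          simpa using h5

theorem IsRGS.mem_of_le {w : List ℕ} (h : IsRGS w) {x : ℕ} (hx : 1 ≤ x)
    (hxw : x ≤ w.foldr max 0) : x ∈ w := by
  induction w using List.reverseRecOn with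
  | nil => simp at hxw; omega
  | append_singleton w c ih =>
    rw [isRGS_concat] at h
    rw [foldr_max_append] at hxw
    simp at hxw ⊢
    by_cases hc : x = c
    · exact Or.inr hc
    · exact Or.inl (ih h.1 (by omega))

open List in
theorem IsRGS.pair_sublist {w : List ℕ} (h : IsRGS w) {x y : ℕ} (hx : 1 ≤ x) (hxy : x < y)
    (hy : y ∈ w) : [x, y] <+ w := by
  induction w using List.reverseRecOn with
  | nil => simp at hy
  | append_singleton w c ih =>
    rw [isRGS_concat] at h
    rcases List.mem_append.1 hy with hy | hy
    · exact (ih h.1 hy).trans (List.sublist_append_left _ _)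
    · rw [List.mem_singleton] at hy
      subst hy
      exact (List.singleton_sublist.2 (h.1.mem_of_le hx (by omega))).append
        (List.Sublist.refl [y])

open List in
theorem concat_sublist_concat {s w : List ℕ} {b c : ℕ} (h : s ++ [b] <+ w ++ [c]) :
    s ++ [b] <+ w ∨ b = c ∧ s <+ w := by
  have h' := List.reverse_sublist.2 h
  simp only [List.reverse_append, List.reverse_singleton, List.singleton_append] at h'
  rcases List.cons_sublist_cons'.1 h' with h' | ⟨rfl, h'⟩
  · left
    simpa using List.reverse_sublist.2 h'
  · exact Or.inr ⟨rfl, List.reverse_sublist.1 (List.cons_sublist_cons.1 h')⟩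

/-- Sequences representing non-crossing partitions, of any length. -/
def IsNC (l : List ℕ) : Prop := IsRGS l ∧ ¬ Crossing l

theorem isNC_nil : IsNC [] :=
  ⟨isRGS_nil, by rintro ⟨i, j, k, m, h⟩; simp at h⟩

theorem not_crossing_of_sublist {l l' : List ℕ} (h : l.Sublist l') (hl' : ¬ Crossing l') :
    ¬ Crossing l := by
  rw [crossing_iff_sublist] at *
  rintro ⟨a, b, hab, hs⟩
  exact hl' ⟨a, b, hab, hs.trans h⟩

theorem IsNC.of_append {w v : List ℕ} (h : IsNC (w ++ v)) : IsNC w := by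
  refine ⟨?_, not_crossing_of_sublist (List.sublist_append_left _ _) h.2⟩
  have h1 := h.1
  clear h
  induction v using List.reverseRecOn with
  | nil => simpa using h1
  | append_singleton v c ih =>
    rw [← List.append_assoc, isRGS_concat] at h1
    exact ih h1.1

theorem IsNC.concat_max {w : List ℕ} (h : IsNC w) : IsNC (w ++ [w.foldr max 0 + 1]) := by
  refine ⟨(isRGS_concat _ _).2 ⟨h.1, by omega, le_rfl⟩, ?_⟩
  have h2 := h.2
  rw [crossing_iff_sublist] at *
  rintro ⟨a, b, hab, hs⟩
  rcases concat_sublist_concat (s := [a, b, a]) hs with hs | ⟨rfl, hs⟩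
  · exact h2 ⟨a, b, hab, hs⟩
  · have := le_foldr_max (hs.subset (show w.foldr max 0 + 1 ∈ _ by simp))
    omega

theorem IsNC.concat_concat_iff {w : List ℕ} {c : ℕ} (h : IsNC (w ++ [c])) (d : ℕ) :
    IsNC (w ++ [c] ++ [d]) ↔
      (IsNC (w ++ [d]) ∧ d ≤ c) ∨ d = (w ++ [c]).foldr max 0 + 1 := by
  have hmax : (w ++ [c]).foldr max 0 = max (w.foldr max 0) c := by
    rw [foldr_max_append]; simp
  obtain ⟨hw, hc1, hc2⟩ := (isRGS_concat _ _).1 h.1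
  constructor
  · intro hd
    rw [or_iff_not_imp_right]
    intro hne
    obtain ⟨-, hd1, hd2⟩ := (isRGS_concat _ _).1 hd.1
    rw [hmax] at hne hd2
    have hdc : d ≤ c := by
      by_contra hlt
      have hdw : d ∈ w := hw.mem_of_le hd1 (by omega)
      refine hd.2 ((crossing_iff_sublist _).2 ⟨c, d, by omega, ?_⟩)
      exact ((hw.pair_sublist hc1 (by omega) hdw).append (List.Sublist.refl [c])).append
        (List.Sublist.refl [d])
    refine ⟨⟨(isRGS_concat _ _).2 ⟨hw, hd1, by omega⟩, ?_⟩, hdc⟩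
    exact not_crossing_of_sublist
      ((List.sublist_append_left w [c]).append (List.Sublist.refl [d])) hd.2
  · rintro (⟨hd, hdc⟩ | rfl)
    · obtain ⟨-, hd1, hd2⟩ := (isRGS_concat _ _).1 hd.1
      refine ⟨(isRGS_concat _ _).2 ⟨h.1, hd1, by omega⟩, ?_⟩
      have h2 := h.2
      have hd2 := hd.2
      rw [crossing_iff_sublist] at *
      rintro ⟨a, b, hab, hs⟩
      rcases concat_sublist_concat (s := [a, b, a]) hs with hs | ⟨rfl, hs'⟩
      · exact h2 ⟨a, b, hab, hs⟩
      · rcases concat_sublist_concat (s := [a, b]) hs' with hs | ⟨rfl, -⟩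
        · exact hd2 ⟨a, b, hab, hs.append (List.Sublist.refl [b])⟩
        · omega
    · exact h.concat_max

open Classical in
/-- The letters that extend `w` to a longer non-crossing sequence. -/
noncomputable def nextLetters (w : List ℕ) : Finset ℕ :=
  (Finset.range (w.foldr max 0 + 2)).filter fun c => IsNC (w ++ [c])

theorem mem_nextLetters {w : List ℕ} {c : ℕ} : c ∈ nextLetters w ↔ IsNC (w ++ [c]) := by
  simp only [nextLetters, Finset.mem_filter, Finset.mem_range, and_iff_right_iff_imp]
  intro h
  have := ((isRGS_concat _ _).1 h.1).2.2
  omega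

theorem nextLetters_concat {w : List ℕ} {c : ℕ} (h : IsNC (w ++ [c])) :
    nextLetters (w ++ [c]) =
      insert ((w ++ [c]).foldr max 0 + 1) ((nextLetters w).filter (· ≤ c)) := by
  ext d
  rw [mem_nextLetters, h.concat_concat_iff, Finset.mem_insert, Finset.mem_filter,
    mem_nextLetters, or_comm]

theorem card_nextLetters_concat {w : List ℕ} {c : ℕ} (h : IsNC (w ++ [c])) :
    (nextLetters (w ++ [c])).card = ((nextLetters w).filter (· ≤ c)).card + 1 := by
  rw [nextLetters_concat h, Finset.card_insert_of_notMem]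
  have := le_foldr_max (show c ∈ w ++ [c] by simp)
  simp only [Finset.mem_filter, not_and, not_le]
  omega

/-- The words `v` of length `n` such that `w ++ v` is a non-crossing sequence. -/
noncomputable def extensions : ℕ → List ℕ → Finset (List ℕ)
  | 0, _ => {[]}
  | n + 1, w => (nextLetters w).biUnion fun c => (extensions n (w ++ [c])).image (List.cons c)

theorem mem_extensions {n : ℕ} {w v : List ℕ} (hw : IsNC w) :
    v ∈ extensions n w ↔ v.length = n ∧ IsNC (w ++ v) := by
  induction n generalizing w v with
  | zero =>
    simp only [extensions, Finset.mem_singleton, List.length_eq_zero_iff]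
    constructor
    · rintro rfl
      simpa using hw
    · exact And.left
  | succ n ih =>
    simp only [extensions, Finset.mem_biUnion, Finset.mem_image, mem_nextLetters]
    constructor
    · rintro ⟨c, hc, v, hv, rfl⟩
      rw [ih hc] at hv
      simpa using hv
    · rintro ⟨hlen, hv⟩
      obtain ⟨c, v, rfl⟩ := List.exists_cons_of_length_eq_add_one hlen
      have hv' : IsNC (w ++ [c] ++ v) := by simpa using hv
      exact ⟨c, hv'.of_append, v, (ih hv'.of_append).2 ⟨by simpa using hlen, hv'⟩, rfl⟩

/-- The number of sequences of `n` further stack heights, each at least one and at most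
one more than its predecessor, that may follow the height `s`. -/
def heightCount : ℕ → ℕ → ℕ
  | 0, _ => 1
  | n + 1, s => ∑ j ∈ Finset.range (s + 1), heightCount n (j + 1)

theorem sum_card_filter_le (A : Finset ℕ) (f : ℕ → ℕ) :
    ∑ c ∈ A, f (A.filter (· ≤ c)).card = ∑ j ∈ Finset.range A.card, f (j + 1) := by
  induction A using Finset.induction_on_max with
  | empty => simp
  | insert a A hA ih =>
    have ha : a ∉ A := fun h => lt_irrefl _ (hA a h)
    rw [Finset.sum_insert ha, Finset.card_insert_of_notMem ha, Finset.sum_range_succ, ← ih,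
      add_comm]
    congr 1
    · refine Finset.sum_congr rfl fun c hc => ?_
      rw [Finset.filter_insert, if_neg (not_le.2 (hA c hc))]
    · rw [Finset.filter_true_of_mem, Finset.card_insert_of_notMem ha]
      intro x hx
      rcases Finset.mem_insert.1 hx with rfl | hx
      · exact le_rfl
      · exact (hA x hx).le

theorem card_extensions {n s : ℕ} {w : List ℕ} (hs : (nextLetters w).card = s + 1) :
    (extensions n w).card = heightCount n s := by
  induction n generalizing w s with
  | zero => simp [extensions, heightCount]
  | succ n ih =>
    rw [extensions, Finset.card_biUnion, heightCount, ← hs,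
      ← sum_card_filter_le _ (heightCount n)]
    · refine Finset.sum_congr rfl fun c hc => ?_
      rw [Finset.card_image_of_injective _ (List.cons_injective),
        ih (card_nextLetters_concat (mem_nextLetters.1 hc))]
    · intro c _ d _ hcd
      rw [Function.onFun, Finset.disjoint_left]
      simp only [Finset.mem_image]
      rintro _ ⟨v, -, rfl⟩ ⟨v', -, h⟩
      exact hcd (List.cons.inj h).1.symm

theorem heightCount_succ_succ (n s : ℕ) :
    heightCount (n + 1) (s + 1) = heightCount (n + 1) s + heightCount n (s + 2) := by
  simp only [heightCount]
  rw [Finset.sum_range_succ]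

theorem heightCount_add_choose (n s : ℕ) :
    heightCount (n + 1) s + (2 * (n + 1) + s).choose n = (2 * (n + 1) + s).choose (n + 1) := by
  induction n generalizing s with
  | zero => simp [heightCount]; omega
  | succ n ih =>
    induction s with
    | zero =>
      have h1 : heightCount (n + 1 + 1) 0 = heightCount (n + 1) 1 := by
        rw [heightCount]; simp
      have h2 := ih 1
      have h3 := Nat.choose_succ_succ (2 * (n + 1) + 1) n
      have h4 := Nat.choose_succ_succ (2 * (n + 1) + 1) (n + 1)
      have h5 := Nat.choose_symm_half (n + 1)
      simp only [Nat.succ_eq_add_one, mul_add, mul_one, add_zero] at *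
      grind
    | succ s ihs =>
      have h2 := ih (s + 2)
      have h3 := Nat.choose_succ_succ (2 * (n + 1 + 1) + s) n
      have h4 := Nat.choose_succ_succ (2 * (n + 1 + 1) + s) (n + 1)
      rw [heightCount_succ_succ]
      rw [show 2 * (n + 1) + (s + 2) = 2 * (n + 1 + 1) + s by ring] at h2
      rw [show 2 * (n + 1 + 1) + (s + 1) = 2 * (n + 1 + 1) + s + 1 by ring]
      simp only [Nat.succ_eq_add_one] at *
      omega

theorem heightCount_zero_right (n : ℕ) : heightCount n 0 = catalan n := by
  cases n with
  | zero => simp [heightCount]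
  | succ n =>
    have h1 := heightCount_add_choose n 0
    have h2 := succ_mul_catalan_eq_centralBinom (n + 1)
    have h3 := Nat.choose_succ_right_eq (2 * (n + 1)) n
    rw [Nat.centralBinom] at h2
    rw [show 2 * (n + 1) - n = n + 2 by omega] at h3
    rw [add_zero] at h1
    have h4 : (n + 2) * heightCount (n + 1) 0 = (n + 2) * catalan (n + 1) := by
      rw [show n + 1 + 1 = n + 2 by ring] at h2
      rw [h2]
      nlinarith
    exact Nat.eq_of_mul_eq_mul_left (by omega) h4

theorem card_nextLetters_nil : (nextLetters []).card = 1 := by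
  rw [Finset.card_eq_one]
  refine ⟨1, ?_⟩
  ext c
  rw [mem_nextLetters, Finset.mem_singleton]
  constructor
  · intro h
    have := ((isRGS_concat _ _).1 h.1).2
    simp at this
    omega
  · rintro rfl
    exact isNC_nil.concat_max

theorem card_NCseq (n : ℕ) : Nat.card {l : List ℕ // NCseq n l} = catalan n := by
  rw [← heightCount_zero_right, ← card_extensions card_nextLetters_nil]
  refine Nat.subtype_card _ fun l => ?_
  rw [mem_extensions isNC_nil]
  rfl

theorem isRGS_duplicate (u v : List ℕ) (x : ℕ) :
    IsRGS (u ++ x :: x :: v) ↔ IsRGS (u ++ x :: v) := by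
  induction v using List.reverseRecOn with
  | nil =>
    rw [show u ++ [x, x] = u ++ [x] ++ [x] by simp, isRGS_concat (u ++ [x]),
      and_iff_left_iff_imp]
    intro h
    have := (isRGS_concat _ _).1 h
    have := le_foldr_max (show x ∈ u ++ [x] by simp)
    omega
  | append_singleton v c ih =>
    rw [show u ++ x :: x :: (v ++ [c]) = u ++ x :: x :: v ++ [c] by simp,
      show u ++ x :: (v ++ [c]) = u ++ x :: v ++ [c] by simp, isRGS_concat, isRGS_concat, ih]
    simp

open List in
theorem sublist_of_sublist_duplicate {s u v : List ℕ} {x : ℕ} (hs : s.IsChain (· ≠ ·))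
    (h : s <+ u ++ x :: x :: v) : s <+ u ++ x :: v := by
  obtain ⟨s₁, s₂, rfl, h₁, h₂⟩ := List.sublist_append_iff.1 h
  refine h₁.append ?_
  have hs₂ := hs.right_of_append
  rcases List.sublist_cons_iff.1 h₂ with h₂ | ⟨t, rfl, ht⟩
  · exact h₂
  · rcases List.sublist_cons_iff.1 ht with ht | ⟨r, rfl, -⟩
    · exact ht.cons_cons x
    · simp at hs₂

theorem crossing_duplicate (u v : List ℕ) (x : ℕ) :
    Crossing (u ++ x :: x :: v) ↔ Crossing (u ++ x :: v) := by
  simp only [crossing_iff_sublist]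
  refine exists_congr fun a => exists_congr fun b => and_congr_right fun hab => ⟨fun h => ?_,
    fun h => h.trans ((List.Sublist.refl u).append (List.sublist_cons_self _ _))⟩
  exact sublist_of_sublist_duplicate (by simp; omega) h

theorem isNC_replicate (u v : List ℕ) (x k : ℕ) :
    IsNC (u ++ List.replicate (k + 1) x ++ v) ↔ IsNC (u ++ x :: v) := by
  induction k with
  | zero => simp
  | succ k ih =>
    rw [← ih]
    simp only [List.replicate_succ, List.append_assoc, List.cons_append, IsNC,
      isRGS_duplicate, crossing_duplicate]

theorem occAt_replicate_append (u v : List ℕ) (x m : ℕ) :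
    occAt (List.replicate m 1) (u ++ List.replicate m x ++ v) u.length := by
  have : ((u ++ List.replicate m x ++ v).drop u.length).take m = List.replicate m x := by
    simp
  rw [occAt, List.length_replicate, this]
  refine ⟨by simp, fun j k hj hk => ?_⟩
  rw [List.length_replicate] at hj hk
  simp [hj, hk]

theorem exists_eq_of_occAt_replicate {l : List ℕ} {m i : ℕ} (hm : 1 ≤ m)
    (h : occAt (List.replicate m 1) l i) :
    ∃ u x v, l = u ++ List.replicate m x ++ v ∧ u.length = i := by
  obtain ⟨hlen, h⟩ := h
  rw [List.length_replicate] at hlen h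
  set t := (l.drop i).take m with ht
  have hil : i + m ≤ l.length := by
    have := hlen
    simp [ht] at this
    omega
  have hrep : t = List.replicate m (t.getD 0 0) := by
    refine List.ext_getElem (by simp [← hlen]) fun j hj _ => ?_
    have h1 := h j 0 (by omega) (by omega)
    have h2 := h 0 j (by omega) (by omega)
    rw [List.getD_replicate _ (show j < m by omega),
      List.getD_replicate _ (show 0 < m by omega), List.getD_eq_getElem _ _ hj] at h1 h2
    rw [List.getElem_replicate]
    omega
  refine ⟨l.take i, t.getD 0 0, l.drop (i + m), ?_, by simp; omega⟩
  rw [← hrep, ht, ← List.drop_drop, List.append_assoc, List.take_append_drop,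
    List.take_append_drop]

theorem eq_take_cons_drop {l : List ℕ} {i : ℕ} (hi : i < l.length) :
    l = l.take i ++ l.getD i 0 :: l.drop (i + 1) := by
  rw [List.getD_eq_getElem _ _ hi, List.cons_getElem_drop_succ, List.take_append_drop]

theorem NCseq.marked {n m : ℕ} (hm : 1 ≤ m) (hmn : m ≤ n) {l : List ℕ}
    (hl : NCseq (n + 1 - m) l) {i : ℕ} (hi : i < n + 1 - m) :
    NCseq n (l.take i ++ List.replicate m (l.getD i 0) ++ l.drop (i + 1)) ∧
      occAt (List.replicate m 1)
        (l.take i ++ List.replicate m (l.getD i 0) ++ l.drop (i + 1)) i := by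
  obtain ⟨hlen, hnc⟩ := hl
  have hil : i < l.length := by omega
  refine ⟨⟨?_, ?_⟩, ?_⟩
  · simp
    omega
  · obtain ⟨k, rfl⟩ := Nat.exists_eq_add_of_le' hm
    refine (isNC_replicate _ _ _ _).2 ?_
    rw [← eq_take_cons_drop hil]
    exact hnc
  · have := occAt_replicate_append (l.take i) (l.drop (i + 1)) (l.getD i 0) m
    rwa [List.length_take, min_eq_left hil.le] at this

/-- Repeating the letter at a marked position until it occurs `m` times in a row. -/
def markRun {n m : ℕ} (hm : 1 ≤ m) (hmn : m ≤ n)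
    (q : {l : List ℕ // NCseq (n + 1 - m) l} × Fin (n + 1 - m)) :
    {p : List ℕ × ℕ // NCseq n p.1 ∧ occAt (List.replicate m 1) p.1 p.2} :=
  ⟨(q.1.1.take q.2 ++ List.replicate m (q.1.1.getD q.2 0) ++ q.1.1.drop (q.2 + 1), q.2),
    q.1.2.marked hm hmn q.2.2⟩

theorem markRun_bijective {n m : ℕ} (hm : 1 ≤ m) (hmn : m ≤ n) :
    Function.Bijective (markRun hm hmn) := by
  constructor
  · rintro ⟨⟨l, hl⟩, i, hi⟩ ⟨⟨l', hl'⟩, i', hi'⟩ h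
    simp only [markRun, Subtype.mk.injEq, Prod.mk.injEq] at h
    obtain ⟨h, rfl⟩ := h
    have hil : i < l.length := hl.1 ▸ hi
    have hil' : i < l'.length := hl'.1 ▸ hi
    obtain ⟨h, h₃⟩ := List.append_inj h (by simp; omega)
    obtain ⟨h₁, h₂⟩ := List.append_inj h (by simp; omega)
    have h₂ := List.replicate_right_injective (by omega) h₂
    have : l = l' := by
      rw [eq_take_cons_drop hil, eq_take_cons_drop hil', h₁, h₂, h₃]
    subst this
    rfl
  · rintro ⟨⟨p, i⟩, ⟨hlen, hnc⟩, hocc⟩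
    obtain ⟨u, x, v, rfl, rfl⟩ := exists_eq_of_occAt_replicate hm hocc
    have hlen' : u.length + m + v.length = n := by
      simpa [add_assoc] using hlen
    have hnc' : IsNC (u ++ x :: v) := by
      obtain ⟨k, rfl⟩ := Nat.exists_eq_add_of_le' hm
      exact (isNC_replicate _ _ _ _).1 hnc
    refine ⟨⟨⟨u ++ x :: v, by simp; omega, hnc'⟩, ⟨u.length, by omega⟩⟩, ?_⟩
    simp [markRun]

/-- Occurrences of the subword 1^m in members of NC_n are in bijection with
pairs (π, i) with π ∈ NC_r and i ∈ [r], where r = n − m + 1; hence the total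
number of occurrences of 1^m over NC_n is r·C_r. -/
theorem stmt4 (n m : ℕ) (hm : 1 ≤ m) (hmn : m ≤ n) :
    Nonempty
      (({l : List ℕ // NCseq (n + 1 - m) l} × Fin (n + 1 - m)) ≃
        {p : List ℕ × ℕ // NCseq n p.1 ∧ occAt (List.replicate m 1) p.1 p.2}) ∧
    totalOcc n (List.replicate m 1) = (n + 1 - m) * catalan (n + 1 - m) := by
  refine ⟨⟨Equiv.ofBijective _ (markRun_bijective hm hmn)⟩, ?_⟩
  rw [totalOcc, ← Nat.card_congr (Equiv.ofBijective _ (markRun_bijective hm hmn)),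
    Nat.card_prod, card_NCseq, Nat.card_fin, mul_comm]
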